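/- (Bukh's theorem.) Let λ₁, …, λ_k be nonzero integers whose greatest common divisor is 1, and set M = |λ₁| + … + |λ_k|. For every ε > 0 there exists N such that every finite set A ⊆ ℤ with |A| ≥ N satisfies |λ₁·A + λ₂·A + … + λ_k·A| ≥ (M − ε)·|A|. -/

import Mathlib

open Pointwise

/-- Finsets separated by a key function and contained in `Z` have total size at most `#Z`. -/
theorem sum_card_le_card_of_key {ι β : Type*} [DecidableEq ι] (T : Finset ι) (f : ι → Finset β)
    (key : β → ι) (Z : Finset β) (h : ∀ i ∈ T, ∀ b ∈ f i, b ∈ Z ∧ key b = i) :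
    ∑ i ∈ T, (f i).card ≤ Z.card := by
  calc ∑ i ∈ T, (f i).card ≤ ∑ i ∈ T, (Z.filter fun b => key b = i).card :=
        Finset.sum_le_sum fun i hi => Finset.card_le_card fun b hb =>
          Finset.mem_filter.2 (h i hi b hb)
    _ = (Z.filter fun b => key b ∈ T).card := Finset.sum_card_fiberwise_eq_card_filter Z T key
    _ ≤ Z.card := Finset.card_filter_le _ _

theorem mem_sum_finset {ι G : Type*} [AddCommMonoid G] [DecidableEq G] (s : Finset ι)
    (f : ι → Finset G) (a : G) :
    a ∈ ∑ i ∈ s, f i ↔ ∃ g : ι → G, (∀ i ∈ s, g i ∈ f i) ∧ ∑ i ∈ s, g i = a := by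
  rw [← Finset.mem_coe, Finset.coe_sum, Set.mem_finsetSum]
  simp

/-- If the value of `x + y` determines a colour of `x` and a colour of `y`, then `#(X + Y)` gains
from the numbers of colours. -/
theorem card_add_of_colouring {κ₁ κ₂ : Type*} [DecidableEq κ₁] [DecidableEq κ₂]
    (X Y : Finset ℤ) (α : ℤ → κ₁) (β : ℤ → κ₂)
    (h : ∀ x ∈ X, ∀ x' ∈ X, ∀ y ∈ Y, ∀ y' ∈ Y, x + y = x' + y' → α x = α x' ∧ β y = β y') :
    (Y.image β).card * X.card + (X.image α).card * Y.card ≤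
      (X + Y).card + (X.image α).card * (Y.image β).card := by
  classical
  set P := X.image α ×ˢ Y.image β
  let XX : κ₁ → Finset ℤ := fun e => X.filter fun x => α x = e
  let YY : κ₂ → Finset ℤ := fun e => Y.filter fun y => β y = e
  have hdisj : ∑ p ∈ P, (XX p.1 + YY p.2).card ≤ (X + Y).card := by
    rw [← Finset.card_biUnion]
    · apply Finset.card_le_card
      intro z hz
      simp only [Finset.mem_biUnion, Finset.mem_add, XX, YY, Finset.mem_filter] at hz
      obtain ⟨p, -, x, ⟨hx, -⟩, y, ⟨hy, -⟩, rfl⟩ := hz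
      exact Finset.add_mem_add hx hy
    · intro p _ p' _ hne
      rw [Function.onFun, Finset.disjoint_left]
      intro z hz hz'
      simp only [Finset.mem_add, XX, YY, Finset.mem_filter] at hz hz'
      obtain ⟨x, ⟨hx, hx1⟩, y, ⟨hy, hy1⟩, rfl⟩ := hz
      obtain ⟨x', ⟨hx', hx1'⟩, y', ⟨hy', hy1'⟩, he⟩ := hz'
      obtain ⟨h1, h2⟩ := h x hx x' hx' y hy y' hy' he.symm
      exact hne (Prod.ext (by rw [← hx1, ← hx1', h1]) (by rw [← hy1, ← hy1', h2]))
  have hX : X.card = ∑ e ∈ X.image α, (XX e).card := Finset.card_eq_sum_card_image α X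
  have hY : Y.card = ∑ e ∈ Y.image β, (YY e).card := Finset.card_eq_sum_card_image β Y
  have hcell : ∑ p ∈ P, ((XX p.1).card + (YY p.2).card) ≤ ∑ p ∈ P, ((XX p.1 + YY p.2).card + 1) := by
    apply Finset.sum_le_sum
    intro p hp
    simp only [P, Finset.mem_product, Finset.mem_image] at hp
    obtain ⟨⟨x, hx, hx1⟩, y, hy, hy1⟩ := hp
    have := cauchy_davenport_add_of_linearOrder_isCancelAdd (s := XX p.1) (t := YY p.2)
      ⟨x, by simp [XX, hx, hx1]⟩ ⟨y, by simp [YY, hy, hy1]⟩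
    omega
  have e1 : ∑ p ∈ P, ((XX p.1).card + (YY p.2).card) =
      (Y.image β).card * X.card + (X.image α).card * Y.card := by
    rw [Finset.sum_add_distrib, Finset.sum_product, Finset.sum_product, hX, hY]
    simp [Finset.mul_sum]
  rw [e1, Finset.sum_add_distrib, ← Finset.card_eq_sum_ones, Finset.card_product] at hcell
  omega

/-- Adding a dilate to a set of multiples of `d`, when both sets meet all available residue
classes modulo `m`. -/
theorem card_add_dilate_of_residues (b d m : ℤ) (hb : b ≠ 0) (hd : 0 < d) (hbm : b ∣ m)
    (hdm : d ∣ m) (X Y : Finset ℤ) (hX : ∀ x ∈ X, d ∣ x)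
    (hXm : ∀ z, d ∣ z → ∃ x ∈ X, m ∣ x - z) (hYm : ∀ z, ∃ y ∈ Y, m ∣ y - z) :
    |b| * Y.card + d * X.card ≤
      Int.gcd b d * (Y.image (fun y => b • y) + X).card + |b| * d := by
  obtain ⟨g, p, q, hg, hcop, hbp, hdq⟩ : ∃ g p q : ℤ, 0 < g ∧ IsCoprime p q ∧ b = p * g ∧
      d = q * g := by
    have hpos : 0 < Int.gcd b d := Int.gcd_pos_of_ne_zero_left _ hb
    obtain ⟨p, q, h1, h2, h3⟩ := Int.exists_gcd_one hpos
    exact ⟨Int.gcd b d, p, q, by exact_mod_cast hpos, Int.isCoprime_iff_gcd_eq_one.2 h1, h2, h3⟩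
  have hp0 : p ≠ 0 := by rintro rfl; simp at hbp; exact hb hbp
  have hq0 : 0 < q := by
    by_contra h
    have := mul_nonpos_of_nonpos_of_nonneg (not_lt.1 h) hg.le
    omega
  have hgcd : (Int.gcd b d : ℤ) = g := by
    rw [hbp, hdq, Int.gcd_mul_right, Int.isCoprime_iff_gcd_eq_one.1 hcop]
    simp [abs_of_pos hg]
  have : NeZero p.natAbs := ⟨by simpa using hp0⟩
  have : NeZero q.natAbs := ⟨by simpa using hq0.ne'⟩
  have hcast (n y z : ℤ) : ((y : ℤ) : ZMod n.natAbs) = (z : ℤ) ↔ n ∣ y - z := by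
    rw [← sub_eq_zero, ← Int.cast_sub, ZMod.intCast_zmod_eq_zero_iff_dvd, Int.natAbs_dvd]
  let α : ℤ → ZMod p.natAbs := fun x => ((x / d : ℤ) : ZMod p.natAbs)
  let β : ℤ → ZMod q.natAbs := fun z => ((z / b : ℤ) : ZMod q.natAbs)
  have hα : X.image α = Finset.univ := by
    refine Finset.eq_univ_iff_forall.2 fun c => ?_
    obtain ⟨z, rfl⟩ := ZMod.intCast_surjective c
    obtain ⟨x, hx, hxm⟩ := hXm (d * z) (dvd_mul_right _ _)
    obtain ⟨x', rfl⟩ := hX x hx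
    refine Finset.mem_image.2 ⟨_, hx, ?_⟩
    simp only [α]
    rw [Int.mul_ediv_cancel_left _ hd.ne', hcast]
    have h1 : b * q ∣ m := by
      obtain ⟨m1, rfl⟩ := hbm
      obtain ⟨m2, hm2⟩ := hdm
      have h2 : q ∣ m1 := by
        have : q ∣ p * m1 := by
          refine ⟨m2, ?_⟩
          rw [hbp, hdq] at hm2
          have : g * (p * m1) = g * (q * m2) := by linarith
          exact mul_left_cancel₀ hg.ne' this
        exact hcop.symm.dvd_of_dvd_mul_left this
      exact mul_dvd_mul_left _ h2
    have h3 : d * p ∣ d * (x' - z) := by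
      rw [mul_sub]
      refine dvd_trans ?_ hxm
      rwa [hdq, mul_right_comm, mul_comm q p, ← mul_right_comm, ← hbp]
    exact Int.dvd_of_mul_dvd_mul_left hd.ne' h3
  have hβ : (Y.image (fun y => b • y)).image β = Finset.univ := by
    refine Finset.eq_univ_iff_forall.2 fun c => ?_
    obtain ⟨z, rfl⟩ := ZMod.intCast_surjective c
    obtain ⟨y, hy, hym⟩ := hYm z
    refine Finset.mem_image.2 ⟨_, Finset.mem_image_of_mem _ hy, ?_⟩
    simp only [β, smul_eq_mul]
    rw [Int.mul_ediv_cancel_left _ hb, hcast]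
    exact ((Dvd.intro _ hdq.symm).trans hdm).trans hym
  have key := card_add_of_colouring (Y.image (fun y => b • y)) X β α ?_
  · rw [hα, hβ, Finset.card_univ, Finset.card_univ, ZMod.card, ZMod.card,
      Finset.card_image_of_injective _ (smul_right_injective ℤ hb)] at key
    rw [hgcd]
    have key' : |p| * (Y.card : ℤ) + |q| * X.card ≤
        (Y.image (fun y => b • y) + X).card + |q| * |p| := by
      rw [← Int.natCast_natAbs p, ← Int.natCast_natAbs q]; exact_mod_cast key
    rw [abs_of_pos hq0] at key'
    have hb' : |b| = |p| * g := by rw [hbp, abs_mul, abs_of_pos hg]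
    rw [hb', hdq]
    have h1 := mul_le_mul_of_nonneg_left key' hg.le
    have h2 : g * (q * |p|) ≤ g * (q * |p|) * g := by
      have : 0 ≤ g * (q * |p|) := by positivity
      nlinarith
    nlinarith
  · intro y hy y' hy' x hx x' hx' he
    obtain ⟨y, -, rfl⟩ := Finset.mem_image.1 hy
    obtain ⟨y', -, rfl⟩ := Finset.mem_image.1 hy'
    obtain ⟨x, rfl⟩ := hX x hx
    obtain ⟨x', rfl⟩ := hX x' hx'
    simp only [smul_eq_mul, α, β] at he ⊢
    rw [Int.mul_ediv_cancel_left _ hb, Int.mul_ediv_cancel_left _ hb,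
      Int.mul_ediv_cancel_left _ hd.ne', Int.mul_ediv_cancel_left _ hd.ne',
      hcast, hcast]
    have he' : p * (y - y') = q * (x' - x) := by
      rw [hbp, hdq] at he
      have : g * (p * (y - y')) = g * (q * (x' - x)) := by linarith
      exact mul_left_cancel₀ hg.ne' this
    refine ⟨hcop.symm.dvd_of_dvd_mul_left ⟨_, he'⟩, hcop.dvd_of_dvd_mul_left (y := q) ?_⟩
    exact ⟨y' - y, by linarith⟩

/-- Sums of dilates of sets that meet every residue class modulo a common multiple `m` of the
coefficients. -/
theorem card_sum_dilates_of_residues {ι : Type*} (l : ι → ℤ) (m : ℤ) (s : Finset ι)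
    (hs : s.Nonempty) (hl : ∀ i ∈ s, l i ≠ 0) (hd : ∀ i ∈ s, l i ∣ m) :
    ∃ c : ℤ, ∀ C : ι → Finset ℤ, (∀ i ∈ s, ∀ t, ∃ a ∈ C i, m ∣ a - t) →
      (∀ x ∈ ∑ i ∈ s, (C i).image (fun a => l i • a), s.gcd l ∣ x) ∧
      (∀ z, s.gcd l ∣ z → ∃ x ∈ ∑ i ∈ s, (C i).image (fun a => l i • a), m ∣ x - z) ∧
      ∑ i ∈ s, |l i| * (C i).card ≤
        s.gcd l * (∑ i ∈ s, (C i).image (fun a => l i • a)).card + c := by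
  classical
  induction hs using Finset.Nonempty.cons_induction with
  | singleton a =>
    refine ⟨0, fun C hC => ?_⟩
    have ha : l a ≠ 0 := hl a (by simp)
    simp only [Finset.sum_singleton, Finset.gcd_singleton, normalize_dvd_iff]
    refine ⟨?_, ?_, ?_⟩
    · intro x hx
      obtain ⟨y, -, rfl⟩ := Finset.mem_image.1 hx
      exact dvd_mul_right _ _
    · rintro z ⟨z, rfl⟩
      obtain ⟨y, hy, hym⟩ := hC a (by simp) z
      refine ⟨_, Finset.mem_image_of_mem _ hy, ?_⟩
      rw [smul_eq_mul, ← mul_sub]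
      exact hym.mul_left _
    · rw [Finset.card_image_of_injective _ (smul_right_injective ℤ ha), ← Int.abs_eq_normalize]
      simp
  | cons a s ha hs ih =>
    obtain ⟨c, ih⟩ := ih (fun i hi => hl i (Finset.mem_cons_of_mem hi))
      (fun i hi => hd i (Finset.mem_cons_of_mem hi))
    refine ⟨c + |l a| * s.gcd l, fun C hC => ?_⟩
    obtain ⟨h1, h2, h3⟩ := ih C (fun i hi => hC i (Finset.mem_cons_of_mem hi))
    have hla : l a ≠ 0 := hl a (by simp)
    have hdpos : 0 < s.gcd l := by
      obtain ⟨i, hi⟩ := hs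
      have hne : s.gcd l ≠ 0 := fun h => hl i (Finset.mem_cons_of_mem hi)
        (Finset.gcd_eq_zero_iff.1 h i hi)
      have : 0 ≤ s.gcd l := by
        rw [← Finset.normalize_gcd, ← Int.abs_eq_normalize]; exact abs_nonneg _
      omega
    have hdm : s.gcd l ∣ m := by
      obtain ⟨i, hi⟩ := hs
      exact (Finset.gcd_dvd hi).trans (hd i (Finset.mem_cons_of_mem hi))
    simp only [Finset.sum_cons, Finset.gcd_cons]
    rw [← Int.coe_gcd]
    refine ⟨?_, ?_, ?_⟩
    · intro x hx
      obtain ⟨y, hy, x, hx', rfl⟩ := Finset.mem_add.1 hx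
      obtain ⟨y, -, rfl⟩ := Finset.mem_image.1 hy
      exact dvd_add ((Int.gcd_dvd_left _ _).trans (dvd_mul_right _ _))
        ((Int.gcd_dvd_right _ _).trans (h1 x hx'))
    · rintro z ⟨z, rfl⟩
      obtain ⟨y, hy, hym⟩ := hC a (by simp) (Int.gcdA (l a) (s.gcd l) * z)
      obtain ⟨x, hx, hxm⟩ := h2 (s.gcd l * (Int.gcdB (l a) (s.gcd l) * z)) (dvd_mul_right _ _)
      refine ⟨_, Finset.add_mem_add (Finset.mem_image_of_mem _ hy) hx, ?_⟩
      obtain ⟨w, hw⟩ := hym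
      obtain ⟨w', hw'⟩ := hxm
      refine ⟨l a * w + w', ?_⟩
      rw [Int.gcd_eq_gcd_ab, smul_eq_mul]
      linear_combination l a * hw + hw'
    · have := card_add_dilate_of_residues (l a) (s.gcd l) m hla hdpos (hd a (by simp)) hdm _ (C a)
        h1 h2 (hC a (by simp))
      linarith

/-- The part of `n` made of primes dividing `d` splits off. -/
theorem exists_mul_isCoprime_split (d : ℤ) (n : ℕ) (hn : 0 < n) :
    ∃ e f : ℤ, (n : ℤ) = e * f ∧ IsCoprime d f ∧ ∀ b : ℤ, IsCoprime b d → IsCoprime b e := by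
  induction n using Nat.strong_induction_on with
  | _ n ih =>
    by_cases hc : Int.gcd d n = 1
    · exact ⟨1, n, by simp, Int.isCoprime_iff_gcd_eq_one.2 hc, fun b _ => isCoprime_one_right⟩
    · have hcn : Int.gcd d n ∣ n := by exact_mod_cast Int.gcd_dvd_right d n
      obtain ⟨n', hn'⟩ := hcn
      have hn'0 : 0 < n' := Nat.pos_of_ne_zero (by rintro rfl; simp at hn'; omega)
      have hc0 : Int.gcd d n ≠ 0 := by intro h; rw [h] at hn'; simp at hn'; omega
      have hlt : n' < n := by
        have : 2 ≤ Int.gcd d n := by omega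
        nlinarith
      obtain ⟨e, f, h1, h2, h3⟩ := ih n' hlt hn'0
      refine ⟨Int.gcd d n * e, f, ?_, h2, fun b hb => ?_⟩
      · rw [mul_assoc, ← h1]; exact_mod_cast hn'
      · exact (hb.of_isCoprime_of_dvd_right (Int.gcd_dvd_left d n)).mul_right (h3 b hb)

/-- In a group of finite exponent, a sum of dilates of `R` is at least as large as the dilate of
`R` by the greatest common divisor of the coefficients. -/
theorem card_gcd_dilate_le {ι G : Type*} [AddCommGroup G] [DecidableEq G] (n : ℕ) (hn : 0 < n)
    (hG : ∀ x : G, n • x = 0) (l : ι → ℤ) (s : Finset ι) (R : Finset G) :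
    (R.image fun r => s.gcd l • r).card ≤ (∑ i ∈ s, R.image fun r => l i • r).card := by
  classical
  induction s using Finset.cons_induction generalizing R with
  | empty =>
    simp only [Finset.gcd_empty, zero_smul, Finset.sum_empty]
    exact Finset.card_le_card fun x hx => by
      obtain ⟨_, -, rfl⟩ := Finset.mem_image.1 hx
      simp
  | cons a s ha ih =>
    rcases R.eq_empty_or_nonempty with rfl | hR
    · simp
    rw [Finset.sum_cons, Finset.gcd_cons, ← Int.coe_gcd]
    set d := s.gcd l
    by_cases hg0 : Int.gcd (l a) d = 0
    · rw [hg0]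
      refine (Finset.card_le_one.2 ?_).trans (Finset.card_pos.2 ?_)
      · simp
      · refine (hR.image _).add ?_
        obtain ⟨r, hr⟩ := hR
        exact ⟨_, (mem_sum_finset _ _ _).2
          ⟨fun i => l i • r, fun i _ => Finset.mem_image_of_mem _ hr, rfl⟩⟩
    set g : ℤ := ((Int.gcd (l a) d : ℕ) : ℤ) with hg
    obtain ⟨p, q, hpq, hp, hq⟩ := Int.exists_gcd_one (Nat.pos_of_ne_zero hg0)
    rw [← hg] at hp hq
    have hcop : IsCoprime p q := Int.isCoprime_iff_gcd_eq_one.2 hpq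
    obtain ⟨e, f, hef, hqf, he⟩ := exists_mul_isCoprime_split q n hn
    have hpe := he p hcop
    have hG' (x : G) : (e * f) • x = 0 := by rw [← hef, natCast_zsmul, hG]
    -- fibres of `R` over the key `r ↦ f • g • r`
    let key : G → G := fun r => f • g • r
    let F : G → Finset G := fun b => R.filter fun r => key r = b
    obtain ⟨b₀, hb₀, hmax⟩ := Finset.exists_max_image (R.image key)
      (fun b => ((F b).image fun r => g • r).card) (hR.image _)
    have hinj : ((F b₀).image fun r => g • r).card ≤
        (∑ i ∈ s, (F b₀).image fun r => l i • r).card := by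
      refine le_trans (le_of_eq ?_) (ih (F b₀))
      have : ((F b₀).image fun r => d • r) = ((F b₀).image fun r => g • r).image fun r => q • r := by
        rw [Finset.image_image]
        refine Finset.image_congr fun r _ => ?_
        simp only [Function.comp, smul_smul, ← hq]
      rw [this]
      refine (Finset.card_image_of_injOn ?_).symm
      intro x hx y hy hxy
      obtain ⟨x, hxF, rfl⟩ := Finset.mem_image.1 hx
      obtain ⟨y, hyF, rfl⟩ := Finset.mem_image.1 hy
      have h1 : f • (g • x - g • y) = 0 := by
        rw [smul_sub, sub_eq_zero]
        exact (Finset.mem_filter.1 hxF).2.trans (Finset.mem_filter.1 hyF).2.symm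
      have h2 : q • (g • x - g • y) = 0 := by rw [smul_sub, sub_eq_zero]; exact hxy
      obtain ⟨u, v, huv⟩ := hqf
      rw [← sub_eq_zero, ← one_smul ℤ (g • x - g • y), ← huv, add_smul, mul_smul, mul_smul, h1, h2]
      simp
    calc (R.image fun r => g • r).card
        ≤ ∑ b ∈ R.image key, ((F b).image fun r => g • r).card := by
          refine le_trans (Finset.card_le_card ?_) Finset.card_biUnion_le
          intro x hx
          obtain ⟨r, hr, rfl⟩ := Finset.mem_image.1 hx
          exact Finset.mem_biUnion.2 ⟨key r, Finset.mem_image_of_mem _ hr,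
            Finset.mem_image_of_mem _ (Finset.mem_filter.2 ⟨hr, rfl⟩)⟩
      _ ≤ ∑ b ∈ R.image key, (∑ i ∈ s, (F b₀).image fun r => l i • r).card :=
          Finset.sum_le_sum fun b hb => (hmax b hb).trans hinj
      _ ≤ _ := ?_
    -- translates of the largest fibre sum, separated by the class of `l a • r`
    have hrep : ∀ b ∈ R.image key, ∃ r ∈ R, key r = b := fun b hb => Finset.mem_image.1 hb
    choose! ρ hρR hρ using hrep
    have hS (y : G) (hy : y ∈ ∑ i ∈ s, (F b₀).image fun r => l i • r) :
        f • y = ∑ i ∈ s, (l i / g) • b₀ := by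
      obtain ⟨w, hw, rfl⟩ := (mem_sum_finset _ _ _).1 hy
      rw [Finset.smul_sum]
      refine Finset.sum_congr rfl fun i hi => ?_
      obtain ⟨r, hr, hr'⟩ := Finset.mem_image.1 (hw i hi)
      have hgi : g ∣ l i := (Dvd.intro_left _ hq.symm).trans (Finset.gcd_dvd hi)
      rw [← hr', ← (Finset.mem_filter.1 hr).2]
      simp only [key, smul_smul]
      congr 1
      obtain ⟨c, hc⟩ := hgi
      rw [hc, Int.mul_ediv_cancel_left _ (by rw [hg]; exact_mod_cast hg0)]
      ring
    have hcard (b : G) : (∑ i ∈ s, (F b₀).image fun r => l i • r).card =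
        ((∑ i ∈ s, (F b₀).image fun r => l i • r).image fun y => l a • ρ b + y).card :=
      (Finset.card_image_of_injective _ (add_right_injective _)).symm
    rw [Finset.sum_congr rfl fun b _ => hcard b, ← Finset.card_biUnion]
    · refine Finset.card_le_card fun z hz => ?_
      obtain ⟨b, hb, hz⟩ := Finset.mem_biUnion.1 hz
      obtain ⟨y, hy, rfl⟩ := Finset.mem_image.1 hz
      refine Finset.add_mem_add (Finset.mem_image_of_mem _ (hρR b hb)) ?_
      obtain ⟨w, hw, rfl⟩ := (mem_sum_finset _ _ _).1 hy
      refine (mem_sum_finset _ _ _).2 ⟨w, fun i hi => ?_, rfl⟩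
      exact Finset.image_subset_image (Finset.filter_subset _ _) (hw i hi)
    · intro b hb b' hb' hne
      rw [Function.onFun, Finset.disjoint_left]
      intro z hz hz'
      obtain ⟨y, hy, rfl⟩ := Finset.mem_image.1 hz
      obtain ⟨y', hy', he'⟩ := Finset.mem_image.1 hz'
      apply hne
      rw [← hρ b hb, ← hρ b' hb']
      have h1 : p • (key (ρ b') - key (ρ b)) = 0 := by
        have := congrArg (fun x => f • x) he'
        simp only [smul_add, hS y hy, hS y' hy'] at this
        have := add_right_cancel this
        rw [smul_sub, sub_eq_zero]
        simp only [key, smul_smul] at this ⊢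
        rw [hp] at this
        convert this using 2 <;> ring
      have h2 : e • (key (ρ b') - key (ρ b)) = 0 := by
        simp only [key, ← smul_sub]
        rw [smul_smul, hG']
      obtain ⟨u, v, huv⟩ := hpe
      symm
      rw [← sub_eq_zero, ← one_smul ℤ (key (ρ b') - key (ρ b)), ← huv, add_smul, mul_smul,
        mul_smul, h1, h2]
      simp

/-- If every class modulo `Q` met by `A` is hit by `A` in all residues modulo `Q * U`, then each
class modulo `Q` of the sum of dilates represented by large cells is large. -/
theorem le_card_class_of_full_cells {ι : Type*} [Fintype ι] (l : ι → ℤ) (m c : ℤ)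
    (hc : ∀ C : ι → Finset ℤ, (∀ i, ∀ t, ∃ a ∈ C i, m ∣ a - t) →
      ∑ i, |l i| * ((C i).card : ℤ) ≤ (∑ i, (C i).image fun a => l i • a).card + c)
    (Q U : ℕ) (hQ : 0 < Q) (hm : m ∣ U) (A : Finset ℤ)
    (hA : ∀ a ∈ A, ∀ t : ℤ, ∃ b ∈ A, ((Q * U : ℕ) : ℤ) ∣ b - (a + Q * t)) (n : ℕ) (a : ι → ℤ)
    (ha : ∀ i, a i ∈ A) (hn : ∀ i, n ≤ (A.filter fun b : ℤ => (b : ZMod Q) = a i).card) :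
    (∑ i, |l i|) * n ≤ ((∑ i, A.image fun b => l i • b).filter
      fun z : ℤ => (z : ZMod Q) = ∑ i, l i • (a i : ZMod Q)).card + c := by
  have hQ0 : (Q : ℤ) ≠ 0 := by exact_mod_cast hQ.ne'
  let C : ι → Finset ℤ := fun i =>
    (A.filter fun b : ℤ => (b : ZMod Q) = a i).image fun b => (b - a i) / Q
  have hdvd (i : ι) (b : ℤ) (hb : (b : ZMod Q) = a i) : (Q : ℤ) ∣ b - a i :=
    (ZMod.intCast_eq_intCast_iff_dvd_sub _ _ _).1 hb.symm
  have hCcard (i : ι) : (C i).card = (A.filter fun b : ℤ => (b : ZMod Q) = a i).card := by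
    refine Finset.card_image_of_injOn fun b hb b' hb' h => ?_
    obtain ⟨u, hu⟩ := hdvd i b (Finset.mem_filter.1 hb).2
    obtain ⟨u', hu'⟩ := hdvd i b' (Finset.mem_filter.1 hb').2
    simp only [hu, hu', Int.mul_ediv_cancel_left _ hQ0] at h
    subst h
    linarith
  have hres : ∀ i, ∀ t, ∃ b ∈ C i, m ∣ b - t := by
    intro i t
    obtain ⟨b, hb, v, hv⟩ := hA (a i) (ha i) t
    have hv' : b - a i = Q * (t + U * v) := by push_cast at hv; linarith
    refine ⟨(b - a i) / Q, Finset.mem_image_of_mem _ (Finset.mem_filter.2 ⟨hb, ?_⟩), ?_⟩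
    · exact ((ZMod.intCast_eq_intCast_iff_dvd_sub _ _ _).2 ⟨_, hv'⟩).symm
    · rw [hv', Int.mul_ediv_cancel_left _ hQ0]
      simpa using hm.mul_right v
  have h1 := hc C hres
  have h2 : (∑ i, (C i).image fun b => l i • b).card ≤ ((∑ i, A.image fun b => l i • b).filter
      fun z : ℤ => (z : ZMod Q) = ∑ i, l i • (a i : ZMod Q)).card := by
    refine Finset.card_le_card_of_injOn (fun z => Q * z + ∑ i, l i * a i) ?_ ?_
    · intro z hz
      obtain ⟨g, hg, rfl⟩ := (mem_sum_finset _ _ _).1 hz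
      refine Finset.mem_filter.2 ⟨?_, by simp⟩
      rw [mem_sum_finset]
      refine ⟨fun i => Q * g i + l i * a i, fun i _ => ?_, ?_⟩
      · obtain ⟨y, hy, hyg⟩ := Finset.mem_image.1 (hg i (Finset.mem_univ i))
        obtain ⟨b, hb, rfl⟩ := Finset.mem_image.1 hy
        obtain ⟨u, hu⟩ := hdvd i b (Finset.mem_filter.1 hb).2
        refine Finset.mem_image.2 ⟨b, (Finset.mem_filter.1 hb).1, ?_⟩
        rw [hu, Int.mul_ediv_cancel_left _ hQ0, smul_eq_mul] at hyg
        simp only [smul_eq_mul, ← hyg]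
        linear_combination l i * hu
      · simp only [Finset.sum_add_distrib, Finset.mul_sum]
    · intro z _ z' _ h
      simpa [hQ.ne'] using h
  have h3 : (∑ i, |l i|) * n ≤ ∑ i, |l i| * ((C i).card : ℤ) := by
    rw [Finset.sum_mul]
    refine Finset.sum_le_sum fun i _ => mul_le_mul_of_nonneg_left ?_ (abs_nonneg _)
    rw [hCcard]
    exact_mod_cast hn i
  have h2' : ((∑ i, (C i).image fun b => l i • b).card : ℤ) ≤ _ := Nat.cast_le.2 h2
  linarith

/-- If every class modulo `Q` met by `A` is hit by `A` in all residues modulo `Q * U`, then the sum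
of dilates of `A` is almost as large as possible. -/
theorem card_sum_dilates_of_full_cells {ι : Type*} [Fintype ι] (l : ι → ℤ)
    (hgcd : Finset.univ.gcd l = 1) (m c : ℤ)
    (hc : ∀ C : ι → Finset ℤ, (∀ i, ∀ t, ∃ a ∈ C i, m ∣ a - t) →
      ∑ i, |l i| * ((C i).card : ℤ) ≤ (∑ i, (C i).image fun a => l i • a).card + c)
    (hc0 : 0 ≤ c) (Q U : ℕ) (hQ : 0 < Q) (hm : m ∣ U) (hU : 0 < U) (hcU : c ≤ (∑ i, |l i|) * U)
    (A : Finset ℤ) (hA : ∀ a ∈ A, ∀ t : ℤ, ∃ b ∈ A, ((Q * U : ℕ) : ℤ) ∣ b - (a + Q * t)) :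
    ((∑ i, |l i|) * U - c) * A.card ≤ U * (∑ i, A.image fun a => l i • a).card := by
  classical
  have : NeZero Q := ⟨hQ.ne'⟩
  have hQ0 : (Q : ℤ) ≠ 0 := by exact_mod_cast hQ.ne'
  have hU0 : (U : ℤ) ≠ 0 := by exact_mod_cast hU.ne'
  set M := ∑ i, |l i|
  let cell : ZMod Q → Finset ℤ := fun x => A.filter fun b : ℤ => (b : ZMod Q) = x
  have hcellU (a : ℤ) (ha : a ∈ A) : U ≤ (cell a).card := by
    choose b hbA hb using fun t : ℕ => hA a ha t
    rw [← Finset.card_range U]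
    refine Finset.card_le_card_of_injOn b (fun t _ => ?_) fun t ht t' ht' h => ?_
    · refine Finset.mem_filter.2 ⟨hbA t, ?_⟩
      obtain ⟨v, hv⟩ := hb t
      refine ((ZMod.intCast_eq_intCast_iff_dvd_sub _ _ _).2 ⟨t + U * v, ?_⟩).symm
      push_cast at hv
      linarith
    · have h1 : ((Q * U : ℕ) : ℤ) ∣ Q * (t - t') := by
        obtain ⟨v, hv⟩ := hb t
        obtain ⟨v', hv'⟩ := hb t'
        exact ⟨v' - v, by linear_combination hv' - hv + h⟩
      push_cast at h1
      have h2 : (t : ℤ) ≡ t' [ZMOD U] :=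
        (Int.modEq_iff_dvd.2 (Int.dvd_of_mul_dvd_mul_left hQ0 h1)).symm
      exact Nat.ModEq.eq_of_lt_of_lt (Int.natCast_modEq_iff.1 h2)
        (Finset.mem_range.1 ht) (Finset.mem_range.1 ht')
  let R : ℕ → Finset (ZMod Q) := fun t =>
    (A.image fun a : ℤ => (a : ZMod Q)).filter fun x => t ≤ (cell x).card
  let S : ℕ → Finset (ZMod Q) := fun t => ∑ i, (R t).image fun x => l i • x
  let T := Finset.Icc 1 A.card
  have hRS (t : ℕ) : (R t).card ≤ (S t).card := by
    have := card_gcd_dilate_le (G := ZMod Q) Q hQ (by simp) l Finset.univ (R t)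
    simpa only [hgcd, one_smul, Finset.image_id'] using this
  have hmass : A.card = ∑ t ∈ T, (R t).card := by
    rw [Finset.card_eq_sum_card_image (fun a : ℤ => (a : ZMod Q)) A]
    have := Finset.sum_card_bipartiteAbove_eq_sum_card_bipartiteBelow
      (fun (t : ℕ) (x : ZMod Q) => t ≤ (cell x).card) (s := T)
      (t := A.image fun a : ℤ => (a : ZMod Q))
    refine (Eq.trans ?_ this.symm)
    refine Finset.sum_congr rfl fun x _ => ?_
    have h : T.filter (fun t => t ≤ (cell x).card) = Finset.Icc 1 (cell x).card := by
      ext t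
      have : (cell x).card ≤ A.card := Finset.card_filter_le _ _
      simp only [T, Finset.mem_filter, Finset.mem_Icc]
      omega
    rw [Finset.bipartiteBelow, h, Nat.card_Icc, Nat.add_sub_cancel]
  have hcount : ∑ t ∈ T, (S t).card = ∑ x : ZMod Q, (T.filter fun t => x ∈ S t).card := by
    have := Finset.sum_card_bipartiteAbove_eq_sum_card_bipartiteBelow
      (fun (t : ℕ) (x : ZMod Q) => x ∈ S t) (s := T) (t := Finset.univ)
    simpa [Finset.bipartiteAbove, Finset.bipartiteBelow] using this
  have hclass (x : ZMod Q) : (M * U - c) * (T.filter fun t => x ∈ S t).card ≤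
      U * ((∑ i, A.image fun b => l i • b).filter fun z : ℤ => (z : ZMod Q) = x).card := by
    rcases (T.filter fun t => x ∈ S t).eq_empty_or_nonempty with h | h
    · rw [h]
      simp only [Finset.card_empty, Nat.cast_zero, mul_zero]
      exact mul_nonneg (Nat.cast_nonneg _) (Nat.cast_nonneg _)
    obtain ⟨τ, hτ, hmax⟩ := Finset.exists_max_image _ id h
    have hn : (T.filter fun t => x ∈ S t).card ≤ τ := by
      calc _ ≤ (Finset.Icc 1 τ).card := Finset.card_le_card fun t ht =>
            Finset.mem_Icc.2 ⟨(Finset.mem_Icc.1 (Finset.mem_filter.1 ht).1).1, hmax t ht⟩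
        _ = τ := by simp
    obtain ⟨g, hg, rfl⟩ := (mem_sum_finset _ _ _).1 (Finset.mem_filter.1 hτ).2
    have hrep : ∀ i, ∃ a ∈ A, g i = l i • (a : ZMod Q) ∧ τ ≤ (cell a).card := by
      intro i
      obtain ⟨y, hy, hyg⟩ := Finset.mem_image.1 (hg i (Finset.mem_univ i))
      obtain ⟨hy1, hy2⟩ := Finset.mem_filter.1 hy
      obtain ⟨a, ha, rfl⟩ := Finset.mem_image.1 hy1
      exact ⟨a, ha, hyg.symm, hy2⟩
    choose a ha hga hτa using hrep
    have key := le_card_class_of_full_cells l m c hc Q U hQ hm A hA (max τ U) a ha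
      fun i => max_le (hτa i) (hcellU _ (ha i))
    rw [Finset.sum_congr rfl fun i _ => hga i]
    rw [Finset.sum_congr rfl fun i _ => hga i] at hn
    set N := (T.filter fun t => ∑ i, l i • (a i : ZMod Q) ∈ S t).card
    set X := ((∑ i, A.image fun b => l i • b).filter
      fun z : ℤ => (z : ZMod Q) = ∑ i, l i • (a i : ZMod Q)).card
    set μ := max τ U
    have h1 : (N : ℤ) ≤ μ := by exact_mod_cast hn.trans (le_max_left _ _)
    have h2 : (U : ℤ) ≤ μ := by exact_mod_cast le_max_right τ U
    calc (M * U - c) * (N : ℤ) ≤ (M * U - c) * μ :=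
          mul_le_mul_of_nonneg_left h1 (by linarith)
      _ = U * (M * μ) - c * μ := by ring
      _ ≤ U * (X + c) - c * U := sub_le_sub (mul_le_mul_of_nonneg_left key (by positivity))
          (mul_le_mul_of_nonneg_left h2 hc0)
      _ = U * X := by ring
  calc (M * U - c) * (A.card : ℤ)
      ≤ (M * U - c) * ((∑ x : ZMod Q, (T.filter fun t => x ∈ S t).card : ℕ) : ℤ) := by
        refine mul_le_mul_of_nonneg_left ?_ (by linarith)
        rw [← hcount, hmass]
        exact_mod_cast Finset.sum_le_sum fun t _ => hRS t
    _ = ∑ x : ZMod Q, (M * U - c) * ((T.filter fun t => x ∈ S t).card : ℤ) := by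
        rw [Nat.cast_sum, Finset.mul_sum]
    _ ≤ ∑ x : ZMod Q, U * (((∑ i, A.image fun b => l i • b).filter
          fun z : ℤ => (z : ZMod Q) = x).card : ℤ) := Finset.sum_le_sum fun x _ => hclass x
    _ = U * (∑ i, A.image fun a => l i • a).card := by
        rw [← Finset.mul_sum, ← Nat.cast_sum, Finset.sum_card_fiberwise_eq_card_filter]
        simp

/-- A difference set of size less than `3/2 * #R` is closed under subtraction. -/
theorem sub_mem_sub_self_of_card_lt {G : Type*} [AddCommGroup G] [DecidableEq G] (R : Finset G)
    (h : 2 * (R - R).card < 3 * R.card) {x y : G} (hx : x ∈ R - R) (hy : y ∈ R - R) :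
    x - y ∈ R - R := by
  have key (z : G) (hz : z ∈ R - R) : R.card < 2 * (R ∩ R.image (z + ·)).card := by
    obtain ⟨a, ha, b, hb, rfl⟩ := Finset.mem_sub.1 hz
    have h1 := Finset.card_union_add_card_inter R (R.image (a - b + ·))
    have h2 : (R ∪ R.image (a - b + ·)).card ≤ (R - R).card := by
      refine Finset.card_le_card_of_injOn (· - a) (fun c hc => ?_) fun c _ c' _ h => by simpa using h
      rcases Finset.mem_union.1 hc with hc | hc
      · exact Finset.sub_mem_sub hc ha
      · obtain ⟨d, hd, rfl⟩ := Finset.mem_image.1 hc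
        have : a - b + d - a = d - b := by abel
        simpa only [this, Finset.mem_coe] using Finset.sub_mem_sub hd hb
    rw [Finset.card_image_of_injective _ (add_right_injective _)] at h1
    omega
  obtain ⟨c, hc⟩ := Finset.inter_nonempty_of_card_lt_card_add_card
    (Finset.inter_subset_left (s₁ := R) (s₂ := R.image (x + ·)))
    (Finset.inter_subset_left (s₁ := R) (s₂ := R.image (y + ·)))
    (by have := key x hx; have := key y hy; omega)
  simp only [Finset.mem_inter, Finset.mem_image] at hc
  obtain ⟨⟨-, u, hu, hxu⟩, -, v, hv, hyv⟩ := hc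
  have : x - y = v - u := by
    rw [sub_eq_sub_iff_add_eq_add, hxu, ← hyv, add_comm]
  rw [this]
  exact Finset.sub_mem_sub hv hu

/-- If the differences of `A` have greatest common divisor `v`, then a small image of `A` modulo
`v * W` has a difference set which is larger by a constant factor. -/
theorem card_residues_sub_self (A : Finset ℤ) (v W : ℕ) (hv : 0 < v) (a₀ : ℤ) (ha₀ : a₀ ∈ A)
    (hgcd : ∀ g : ℤ, (∀ a ∈ A, g ∣ a - a₀) → g ∣ v)
    (hW : 2 * (A.image fun a : ℤ => (a : ZMod (v * W))).card < W) :
    3 * (A.image fun a : ℤ => (a : ZMod (v * W))).card ≤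
      2 * ((A.image fun a : ℤ => (a : ZMod (v * W))) -
        A.image fun a : ℤ => (a : ZMod (v * W))).card := by
  set R := A.image fun a : ℤ => (a : ZMod (v * W))
  by_contra! hlt
  have hclosed : ∀ x ∈ (R - R : Finset (ZMod (v * W))), ∀ y ∈ R - R, x + -y ∈ R - R := by
    intro x hx y hy
    rw [← sub_eq_add_neg]
    exact sub_mem_sub_self_of_card_lt R hlt hx hy
  have ha₀R : (a₀ : ZMod (v * W)) ∈ R := Finset.mem_image_of_mem _ ha₀
  let H := AddSubgroup.ofSub ((R - R : Finset (ZMod (v * W))) : Set (ZMod (v * W)))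
    ⟨_, Finset.sub_mem_sub ha₀R ha₀R⟩ hclosed
  let P := H.comap (Int.castAddHom (ZMod (v * W)))
  obtain ⟨g, hg⟩ := Int.subgroup_cyclic P
  rw [← AddSubgroup.zmultiples_eq_closure] at hg
  have hvP : (v : ℤ) ∈ P := by
    rw [hg, Int.mem_zmultiples_iff]
    refine hgcd g fun a ha => ?_
    rw [← Int.mem_zmultiples_iff, ← hg, AddSubgroup.mem_comap]
    change ((a - a₀ : ℤ) : ZMod (v * W)) ∈ R - R
    rw [Int.cast_sub]
    exact Finset.sub_mem_sub (Finset.mem_image_of_mem _ ha) ha₀R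
  have hcard : W ≤ (R - R).card := by
    refine (Finset.card_range W).ge.trans (Finset.card_le_card_of_injOn
      (fun t => ((t • (v : ℤ) : ℤ) : ZMod (v * W)))
      (fun t _ => P.nsmul_mem hvP t) fun t ht t' ht' h => ?_)
    have h1 : ((v * t : ℕ) : ZMod (v * W)) = (v * t' : ℕ) := by
      simpa [mul_comm] using h
    have h2 := (ZMod.natCast_eq_natCast_iff _ _ _).1 h1
    exact Nat.ModEq.eq_of_lt_of_lt (Nat.ModEq.mul_left_cancel' hv.ne' h2)
      (Finset.mem_range.1 ht) (Finset.mem_range.1 ht')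
  omega

/-- Splitting `3A - 2A` over residue classes: the classes of `A` contribute the corresponding sets
of the cells, and every further class of `R + R - R` contributes at least the average cell size. -/
theorem sum_card_cells_le (A : Finset ℤ) (n : ℕ) [NeZero n] (hA : A.Nonempty)
    (hR : 3 * (A.image fun a : ℤ => (a : ZMod n)).card ≤
      2 * ((A.image fun a : ℤ => (a : ZMod n)) - A.image fun a : ℤ => (a : ZMod n)).card)
    (cell : ZMod n → Finset ℤ) (hcell : ∀ x, cell x = A.filter fun a : ℤ => (a : ZMod n) = x) :
    2 * ∑ x ∈ A.image (fun a : ℤ => (a : ZMod n)),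
      (cell x + cell x + cell x - (cell x + cell x)).card + A.card ≤
      2 * (A + A + A - (A + A)).card := by
  set R := A.image fun a : ℤ => (a : ZMod n)
  set Z := A + A + A - (A + A)
  have hmem {x : ZMod n} {a : ℤ} : a ∈ cell x ↔ a ∈ A ∧ (a : ZMod n) = x := by
    rw [hcell, Finset.mem_filter]
  have hRne : R.Nonempty := hA.image _
  obtain ⟨x₀, hx₀, hmax⟩ := Finset.exists_max_image R (fun x => (cell x).card) hRne
  have hAcard : A.card ≤ R.card * (cell x₀).card := by
    rw [Finset.card_eq_sum_card_image (fun a : ℤ => (a : ZMod n)) A, ← smul_eq_mul]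
    refine Finset.sum_le_card_nsmul _ _ _ fun x hx => ?_
    rw [← hcell]
    exact hmax x hx
  set E := (R + R - R) \ R
  have hE : R.card ≤ 2 * E.card := by
    obtain ⟨y, hy⟩ := hRne
    have h1 : R ⊆ R + R - R := fun x hx => by
      simpa using Finset.sub_mem_sub (Finset.add_mem_add hx hy) hy
    have h2 : (R - R).card ≤ (R + R - R).card := by
      refine Finset.card_le_card_of_injOn (y + ·) (fun x hx => ?_) (add_right_injective y).injOn
      obtain ⟨a, ha, b, hb, rfl⟩ := Finset.mem_sub.1 hx
      simpa only [add_sub_assoc, Finset.mem_coe] using Finset.sub_mem_sub (Finset.add_mem_add hy ha) hb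
    have h3 : E.card + R.card = (R + R - R).card := Finset.card_sdiff_add_card_eq_card h1
    omega
  have h1 : ∑ x ∈ R, (cell x + cell x + cell x - (cell x + cell x)).card ≤
      ∑ x ∈ R, (Z.filter fun z : ℤ => (z : ZMod n) = x).card := by
    refine Finset.sum_le_sum fun x _ => Finset.card_le_card fun z hz => ?_
    simp only [Finset.mem_sub, Finset.mem_add] at hz
    obtain ⟨_, ⟨_, ⟨a, ha, b, hb, rfl⟩, c, hc, rfl⟩, _, ⟨d, hd, e, he, rfl⟩, rfl⟩ := hz
    rw [hmem] at ha hb hc hd he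
    refine Finset.mem_filter.2 ⟨Finset.sub_mem_sub (Finset.add_mem_add (Finset.add_mem_add ha.1
      hb.1) hc.1) (Finset.add_mem_add hd.1 he.1), ?_⟩
    push_cast
    rw [ha.2, hb.2, hc.2, hd.2, he.2]
    abel
  have h2 : E.card * (cell x₀).card ≤ ∑ x ∈ E, (Z.filter fun z : ℤ => (z : ZMod n) = x).card := by
    rw [← smul_eq_mul]
    refine Finset.card_nsmul_le_sum _ _ _ fun x hx => ?_
    obtain ⟨_, hij, _, hk, rfl⟩ := Finset.mem_sub.1 (Finset.mem_sdiff.1 hx).1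
    obtain ⟨_, hi, _, hj, rfl⟩ := Finset.mem_add.1 hij
    obtain ⟨a, ha, rfl⟩ := Finset.mem_image.1 hi
    obtain ⟨b, hb, rfl⟩ := Finset.mem_image.1 hj
    obtain ⟨d, hd, rfl⟩ := Finset.mem_image.1 hk
    obtain ⟨e, he, rfl⟩ := Finset.mem_image.1 hx₀
    refine Finset.card_le_card_of_injOn (fun c => a + b + c - (d + e)) (fun c hc => ?_)
      fun c _ c' _ h => by simpa using h
    obtain ⟨hc, hce⟩ := hmem.1 hc
    refine Finset.mem_filter.2 ⟨Finset.sub_mem_sub (Finset.add_mem_add (Finset.add_mem_add ha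
      hb) hc) (Finset.add_mem_add hd he), ?_⟩
    push_cast
    rw [hce]
    abel
  have h3 : ∑ x ∈ R, (Z.filter fun z : ℤ => (z : ZMod n) = x).card +
      ∑ x ∈ E, (Z.filter fun z : ℤ => (z : ZMod n) = x).card ≤ Z.card := by
    rw [← Finset.sum_union Finset.disjoint_sdiff, Finset.sum_card_fiberwise_eq_card_filter]
    exact Finset.card_filter_le _ _
  nlinarith [Nat.mul_le_mul_right (cell x₀).card hE]

/-- A large set of small doubling has a residue class modulo some `Q` which occupies at least half
of the residues modulo `Q * W`. -/
theorem exists_dense_cell (W : ℕ) (hW : 0 < W) (n : ℕ) : ∃ N : ℕ, ∀ A : Finset ℤ, N ≤ A.card →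
    4 * (A + A + A - (A + A)).card ≤ n * A.card → ∃ Q : ℕ, 0 < Q ∧ ∃ r : ZMod Q,
      W ≤ 2 * ((A.filter fun a : ℤ => (a : ZMod Q) = r).image
        fun a : ℤ => (a : ZMod (Q * W))).card := by
  induction n with
  | zero =>
    refine ⟨1, fun A hA h => ?_⟩
    have hne : A.Nonempty := Finset.card_pos.1 hA
    have := (((hne.add hne).add hne).sub (hne.add hne)).card_pos
    omega
  | succ n ih =>
    obtain ⟨N, hN⟩ := ih
    refine ⟨W * (n * N) + 2, fun A hA h => ?_⟩
    obtain ⟨a₀, ha₀, a₁, ha₁, hne⟩ := Finset.one_lt_card.1 (show 1 < A.card by omega)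
    set v := (A.gcd fun a => a - a₀).natAbs
    have hdvd (a : ℤ) (ha : a ∈ A) : (v : ℤ) ∣ a - a₀ :=
      Int.natAbs_dvd.2 (Finset.gcd_dvd (f := fun a => a - a₀) ha)
    have hv0 : 0 < v := by
      refine Nat.pos_of_ne_zero fun h0 => hne ?_
      have := hdvd a₁ ha₁
      rw [h0, Nat.cast_zero, zero_dvd_iff] at this
      omega
    by_cases hR : W ≤ 2 * (A.image fun a : ℤ => (a : ZMod (v * W))).card
    · refine ⟨v, hv0, a₀, ?_⟩
      rwa [Finset.filter_true_of_mem]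
      intro a ha
      exact ((ZMod.intCast_eq_intCast_iff_dvd_sub _ _ _).2 (hdvd a ha)).symm
    push Not at hR
    have : NeZero (v * W) := ⟨(Nat.mul_pos hv0 hW).ne'⟩
    let cell : ZMod (v * W) → Finset ℤ := fun x => A.filter fun a : ℤ => (a : ZMod (v * W)) = x
    have hcells := sum_card_cells_le A (v * W) ⟨a₀, ha₀⟩
      (card_residues_sub_self A v W hv0 a₀ ha₀
        (fun g hg => Int.dvd_natAbs.2 (Finset.dvd_gcd hg)) hR) cell fun _ => rfl
    by_cases hex : ∃ x, N ≤ (cell x).card ∧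
        4 * (cell x + cell x + cell x - (cell x + cell x)).card ≤ n * (cell x).card
    · obtain ⟨x, h1, h2⟩ := hex
      obtain ⟨Q, hQ, r, hr⟩ := hN (cell x) h1 h2
      exact ⟨Q, hQ, r, hr.trans (Nat.mul_le_mul_left 2 (Finset.card_le_card
        (Finset.image_subset_image (Finset.filter_subset_filter _ (Finset.filter_subset _ _)))))⟩
    exfalso
    push Not at hex
    set R := A.image fun a : ℤ => (a : ZMod (v * W))
    have hsum : n * A.card ≤
        4 * ∑ x ∈ R, (cell x + cell x + cell x - (cell x + cell x)).card + W * (n * N) := by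
      rw [Finset.card_eq_sum_card_image (fun a : ℤ => (a : ZMod (v * W))) A, Finset.mul_sum,
        Finset.mul_sum]
      calc ∑ x ∈ R, n * (cell x).card
          ≤ ∑ x ∈ R, (4 * (cell x + cell x + cell x - (cell x + cell x)).card + n * N) := by
            refine Finset.sum_le_sum fun x _ => ?_
            rcases lt_or_ge (cell x).card N with hlt | hge
            · exact (Nat.mul_le_mul_left n hlt.le).trans (Nat.le_add_left _ _)
            · exact (hex x hge).le.trans (Nat.le_add_right _ _)
        _ ≤ _ := by
            rw [Finset.sum_add_distrib, Finset.sum_const, smul_eq_mul]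
            refine Nat.add_le_add_left (Nat.mul_le_mul_right _ ?_) _
            omega
    rw [add_mul] at h
    omega

theorem card_residues_add_mul_card_cell_le (A : Finset ℤ) (n : ℕ) (x : ZMod n) :
    ((A.image fun a : ℤ => (a : ZMod n)) + A.image fun a : ℤ => (a : ZMod n)).card *
      (A.filter fun a : ℤ => (a : ZMod n) = x).card ≤ (A + A + A).card := by
  rw [← smul_eq_mul]
  refine le_trans (Finset.card_nsmul_le_sum _ (fun y => ((A + A + A).filter
    fun z : ℤ => (z : ZMod n) = y + x).card) _ fun y hy => ?_)
    (sum_card_le_card_of_key _ _ (fun z : ℤ => (z : ZMod n) - x) _ fun y _ z hz => ?_)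
  · obtain ⟨_, hi, _, hj, rfl⟩ := Finset.mem_add.1 hy
    obtain ⟨a, ha, rfl⟩ := Finset.mem_image.1 hi
    obtain ⟨b, hb, rfl⟩ := Finset.mem_image.1 hj
    refine Finset.card_le_card_of_injOn (a + b + ·) (fun c hc => ?_) (add_right_injective _).injOn
    obtain ⟨hcA, rfl⟩ := Finset.mem_filter.1 hc
    exact Finset.mem_filter.2 ⟨Finset.add_mem_add (Finset.add_mem_add ha hb) hcA, by simp⟩
  · obtain ⟨h1, h2⟩ := Finset.mem_filter.1 hz
    exact ⟨h1, by rw [h2, add_sub_cancel_right]⟩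

theorem card_residues_add_le (A : Finset ℤ) (hA : A.Nonempty) (K n : ℕ)
    (hK : (A + A + A).card ≤ K * A.card) :
    ((A.image fun a : ℤ => (a : ZMod n)) + A.image fun a : ℤ => (a : ZMod n)).card ≤
      K * (A.image fun a : ℤ => (a : ZMod n)).card := by
  set R := A.image fun a : ℤ => (a : ZMod n)
  obtain ⟨x, hx, hmax⟩ := Finset.exists_max_image R
    (fun x => (A.filter fun a : ℤ => (a : ZMod n) = x).card) (hA.image _)
  have h1 : A.card ≤ R.card * (A.filter fun a : ℤ => (a : ZMod n) = x).card := by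
    rw [Finset.card_eq_sum_card_image (fun a : ℤ => (a : ZMod n)) A, ← smul_eq_mul]
    exact Finset.sum_le_card_nsmul _ _ _ hmax
  have hpos : 0 < (A.filter fun a : ℤ => (a : ZMod n) = x).card :=
    Nat.pos_of_ne_zero fun h0 => by
      rw [h0, mul_zero] at h1
      have := hA.card_pos
      omega
  refine Nat.le_of_mul_le_mul_right ?_ hpos
  calc _ ≤ (A + A + A).card := card_residues_add_mul_card_cell_le A n x
    _ ≤ K * A.card := hK
    _ ≤ K * (R.card * (A.filter fun a : ℤ => (a : ZMod n) = x).card) := Nat.mul_le_mul_left K h1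
    _ = _ := (mul_assoc _ _ _).symm

/-- One dense cell modulo `Q` makes the set of residues modulo `Q * W` dense. -/
theorem card_residues_mul_card_image_cell_le (A : Finset ℤ) (hA : A.Nonempty) (K Q W : ℕ)
    (hK : (A + A + A).card ≤ K * A.card) (r : ZMod Q) :
    (A.image fun a : ℤ => (a : ZMod Q)).card * ((A.filter fun a : ℤ => (a : ZMod Q) = r).image
        fun a : ℤ => (a : ZMod (Q * W))).card ≤
      K * (A.image fun a : ℤ => (a : ZMod (Q * W))).card := by
  refine le_trans ?_ (card_residues_add_le A hA K (Q * W) hK)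
  set R := A.image fun a : ℤ => (a : ZMod (Q * W))
  set P := (A.filter fun a : ℤ => (a : ZMod Q) = r).image fun a : ℤ => (a : ZMod (Q * W))
  have hrep : ∀ x ∈ A.image (fun a : ℤ => (a : ZMod Q)), ∃ a ∈ A, (a : ZMod Q) = x :=
    fun x hx => Finset.mem_image.1 hx
  choose! ρ hρA hρ using hrep
  have hcard (x : ZMod Q) : (P.image ((ρ x : ZMod (Q * W)) + ·)).card = P.card :=
    Finset.card_image_of_injective _ (add_right_injective _)
  rw [← smul_eq_mul, ← Finset.sum_const, ← Finset.sum_congr rfl fun x _ => hcard x]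
  refine sum_card_le_card_of_key _ _
    (fun z => ZMod.castHom (Dvd.intro W rfl) (ZMod Q) z - r) _ fun x hx z hz => ?_
  obtain ⟨y, hy, rfl⟩ := Finset.mem_image.1 hz
  obtain ⟨b, hb, rfl⟩ := Finset.mem_image.1 hy
  obtain ⟨hbA, rfl⟩ := Finset.mem_filter.1 hb
  refine ⟨Finset.add_mem_add (Finset.mem_image_of_mem _ (hρA x hx))
    (Finset.mem_image_of_mem _ hbA), ?_⟩
  rw [map_add, map_intCast, map_intCast, hρ x hx, add_sub_cancel_right]

/-- The class of `a` modulo `Q` consists of `U` classes modulo `Q * U`. -/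
theorem image_cell_subset (A : Finset ℤ) (Q U : ℕ) (hU : 0 < U) (a : ℤ) :
    ((A.filter fun b : ℤ => (b : ZMod Q) = a).image fun b : ℤ => (b : ZMod (Q * U))) ⊆
      (Finset.range U).image fun t : ℕ => ((a + Q * t : ℤ) : ZMod (Q * U)) := by
  intro y hy
  obtain ⟨b, hb, rfl⟩ := Finset.mem_image.1 hy
  obtain ⟨v, hv⟩ := (ZMod.intCast_eq_intCast_iff_dvd_sub _ _ _).1 (Finset.mem_filter.1 hb).2.symm
  have hU' : (0 : ℤ) < U := by exact_mod_cast hU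
  have h0 := Int.emod_nonneg v hU'.ne'
  refine Finset.mem_image.2 ⟨(v % U).toNat, Finset.mem_range.2 ?_, ?_⟩
  · have := Int.emod_lt_of_pos v hU'
    omega
  · rw [ZMod.intCast_eq_intCast_iff_dvd_sub]
    refine ⟨v / U, ?_⟩
    rw [Int.toNat_of_nonneg h0]
    push_cast
    linear_combination hv - Q * Int.emod_add_mul_ediv v U

/-- If `A` has nearly `U` times as many residues modulo `Q * U` as modulo `Q`, then most of `A` lies
in classes modulo `Q` all of whose subclasses modulo `Q * U` are hit. -/
theorem exists_full_cells (A : Finset ℤ) (hA : A.Nonempty) (K Q U D : ℕ) (hU : 0 < U)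
    (hK : (A + A + A).card ≤ K * A.card)
    (hD : D * (U * (A.image fun a : ℤ => (a : ZMod Q)).card) ≤
      D * (A.image fun a : ℤ => (a : ZMod (Q * U))).card +
        U * (A.image fun a : ℤ => (a : ZMod Q)).card) :
    ∃ B ⊆ A, (∀ a ∈ B, ∀ t : ℤ, ∃ b ∈ B, ((Q * U : ℕ) : ℤ) ∣ b - (a + Q * t)) ∧
      D * A.card ≤ D * B.card + U * K * A.card := by
  classical
  set R := A.image fun a : ℤ => (a : ZMod Q)
  let cell : ZMod Q → Finset ℤ := fun x => A.filter fun a : ℤ => (a : ZMod Q) = x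
  let P : ZMod Q → Finset (ZMod (Q * U)) := fun x => (cell x).image fun a : ℤ => (a : ZMod (Q * U))
  have hT (a : ℤ) : ((Finset.range U).image fun t : ℕ =>
      ((a + Q * t : ℤ) : ZMod (Q * U))).card ≤ U :=
    Finset.card_image_le.trans (Finset.card_range U).le
  have hPU : ∀ x ∈ R, (P x).card ≤ U := by
    intro x hx
    obtain ⟨a, -, rfl⟩ := Finset.mem_image.1 hx
    exact (Finset.card_le_card (image_cell_subset A Q U hU a)).trans (hT a)
  refine ⟨A.filter fun a : ℤ => U ≤ (P a).card, Finset.filter_subset _ _, fun a ha t => ?_, ?_⟩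
  · have heq := Finset.eq_of_subset_of_card_le (image_cell_subset A Q U hU a)
      ((hT a).trans (Finset.mem_filter.1 ha).2)
    have hU' : (0 : ℤ) < U := by exact_mod_cast hU
    have h0 := Int.emod_nonneg t hU'.ne'
    have hmem : ((a + Q * (t % U).toNat : ℤ) : ZMod (Q * U)) ∈ (A.filter fun b : ℤ =>
        (b : ZMod Q) = a).image fun b : ℤ => (b : ZMod (Q * U)) := by
      rw [heq]
      refine Finset.mem_image.2 ⟨(t % U).toNat, Finset.mem_range.2 ?_, rfl⟩
      have := Int.emod_lt_of_pos t hU'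
      omega
    obtain ⟨b, hb, hbt⟩ := Finset.mem_image.1 hmem
    obtain ⟨hbA, hba⟩ := Finset.mem_filter.1 hb
    refine ⟨b, Finset.mem_filter.2 ⟨hbA, by rw [hba]; exact (Finset.mem_filter.1 ha).2⟩, ?_⟩
    obtain ⟨v, hv⟩ := (ZMod.intCast_eq_intCast_iff_dvd_sub _ _ _).1 hbt.symm
    refine ⟨v - t / U, ?_⟩
    rw [Int.toNat_of_nonneg h0] at hv
    push_cast at hv ⊢
    linear_combination hv + Q * Int.emod_add_mul_ediv t U
  · set bad := R.filter fun x => ¬ U ≤ (P x).card with hbad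
    have hcover : (A.image fun a : ℤ => (a : ZMod (Q * U))).card ≤ ∑ x ∈ R, (P x).card := by
      refine le_trans (Finset.card_le_card fun y hy => ?_) Finset.card_biUnion_le
      obtain ⟨a, ha, rfl⟩ := Finset.mem_image.1 hy
      exact Finset.mem_biUnion.2 ⟨a, Finset.mem_image_of_mem _ ha,
        Finset.mem_image_of_mem _ (Finset.mem_filter.2 ⟨ha, rfl⟩)⟩
    have hsum : ∑ x ∈ R, (P x).card + bad.card ≤ U * R.card := by
      rw [hbad, Finset.card_filter, ← Finset.sum_add_distrib]
      refine (Finset.sum_le_card_nsmul _ _ U fun x hx => ?_).trans_eq (mul_comm _ _)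
      have := hPU x hx
      split_ifs <;> omega
    have hDbad : D * bad.card ≤ U * R.card := by
      have h3 := Nat.mul_le_mul_left D (show (A.image fun a : ℤ => (a : ZMod (Q * U))).card +
        bad.card ≤ U * R.card by omega)
      rw [mul_add] at h3
      omega
    have hmass : R.card * ∑ x ∈ bad, (cell x).card ≤ bad.card * (K * A.card) := by
      rw [Finset.mul_sum, ← smul_eq_mul]
      refine Finset.sum_le_card_nsmul _ _ _ fun x hx => ?_
      refine le_trans (Nat.mul_le_mul_right _ ?_)
        ((card_residues_add_mul_card_cell_le A Q x).trans hK)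
      exact Finset.card_le_card_add_right (hA.image _)
    have hsplit : A.card = (A.filter fun a : ℤ => U ≤ (P a).card).card +
        ∑ x ∈ bad, (cell x).card := by
      rw [← Finset.card_filter_add_card_filter_not (s := A) (fun a : ℤ => U ≤ (P a).card),
        Finset.sum_card_fiberwise_eq_card_filter]
      congr 2
      refine Finset.filter_congr fun a ha => ?_
      simp [hbad, Finset.mem_image_of_mem (fun a : ℤ => (a : ZMod Q)) ha, R]
    have hRpos : 0 < R.card := (hA.image _).card_pos
    have hfin : D * ∑ x ∈ bad, (cell x).card ≤ U * K * A.card := by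
      refine Nat.le_of_mul_le_mul_left ?_ hRpos
      calc R.card * (D * ∑ x ∈ bad, (cell x).card)
          = D * (R.card * ∑ x ∈ bad, (cell x).card) := by ring
        _ ≤ D * (bad.card * (K * A.card)) := Nat.mul_le_mul_left D hmass
        _ = D * bad.card * (K * A.card) := by ring
        _ ≤ U * R.card * (K * A.card) := Nat.mul_le_mul_right _ hDbad
        _ = _ := by ring
    have := congrArg (D * ·) hsplit
    simp only [mul_add] at this
    omega

theorem add_mul_pow_le_mul_succ_pow (d J : ℕ) : (d + J) * d ^ J ≤ d * (d + 1) ^ J := by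
  induction J with
  | zero => simp
  | succ J ih =>
    calc (d + (J + 1)) * d ^ (J + 1) = (d * d + d * J + d) * d ^ J := by ring
      _ ≤ (d * d + d * J + d + J) * d ^ J := Nat.mul_le_mul_right _ (Nat.le_add_right _ _)
      _ = (d + 1) * ((d + J) * d ^ J) := by ring
      _ ≤ (d + 1) * (d * (d + 1) ^ J) := Nat.mul_le_mul_left _ ih
      _ = _ := by ring

/-- A sequence that grows by `U ^ J` up to a constant factor in `J` steps has a step where it grows
almost by the factor `U`. -/
theorem exists_large_step (f : ℕ → ℕ) (hf : 0 < f 0) (L U d J : ℕ) (hU : 0 < U)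
    (hJ : L * d ^ J < (d + 1) ^ J) (h : f 0 * U ^ J ≤ L * f J) :
    ∃ j, (d + 1) * (U * f j) ≤ (d + 1) * f (j + 1) + U * f j := by
  by_contra! hlt
  have key (j : ℕ) : (d + 1) ^ j * f j ≤ d ^ j * U ^ j * f 0 := by
    induction j with
    | zero => simp
    | succ j ih =>
      have h1 : (d + 1) * f (j + 1) ≤ d * U * f j := by
        have := hlt j
        nlinarith
      calc (d + 1) ^ (j + 1) * f (j + 1) = (d + 1) ^ j * ((d + 1) * f (j + 1)) := by ring
        _ ≤ (d + 1) ^ j * (d * U * f j) := Nat.mul_le_mul_left _ h1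
        _ = d * U * ((d + 1) ^ j * f j) := by ring
        _ ≤ d * U * (d ^ j * U ^ j * f 0) := Nat.mul_le_mul_left _ ih
        _ = _ := by ring
  have : (d + 1) ^ J * (U ^ J * f 0) ≤ L * d ^ J * (U ^ J * f 0) := by
    calc (d + 1) ^ J * (U ^ J * f 0) = (d + 1) ^ J * (f 0 * U ^ J) := by ring
      _ ≤ (d + 1) ^ J * (L * f J) := Nat.mul_le_mul_left _ h
      _ = L * ((d + 1) ^ J * f J) := by ring
      _ ≤ L * (d ^ J * U ^ J * f 0) := Nat.mul_le_mul_left _ (key J)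
      _ = _ := by ring
  exact absurd (Nat.le_of_mul_le_mul_right this (by positivity)) (not_le.2 hJ)

theorem card_three_sub_two_le (X B : Finset ℤ) (M : ℕ) (hB : B.Nonempty) (hBX : B.card ≤ X.card)
    (h : (X + B).card ≤ M * B.card) :
    (B + B + B - (B + B)).card ≤ M ^ 6 * B.card := by
  have hX : X.Nonempty := Finset.card_pos.1 (hB.card_pos.trans_le hBX)
  have key := Finset.pluennecke_ruzsa_inequality_nsmul_sub_nsmul_add hX B 3 2
  rw [show (3 : ℕ) • B = B + B + B by rw [succ_nsmul, two_nsmul], two_nsmul] at key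
  have hpos : (0 : ℚ≥0) < X.card := by exact_mod_cast hX.card_pos
  have h1 : ((X + B).card / X.card : ℚ≥0) ≤ M := by
    rw [div_le_iff₀ hpos]
    exact_mod_cast h.trans (Nat.mul_le_mul_left M hBX)
  have h2 : (X.card : ℚ≥0) ≤ M * B.card := by
    exact_mod_cast (Finset.card_le_card_add_right hB).trans h
  have h3 : ((B + B + B - (B + B)).card : ℚ≥0) ≤ M ^ 6 * B.card := by
    calc _ ≤ ((X + B).card / X.card : ℚ≥0) ^ (3 + 2) * X.card := key
      _ ≤ (M : ℚ≥0) ^ (3 + 2) * (M * B.card) := by gcongr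
      _ = _ := by ring
  exact_mod_cast h3

theorem card_le_card_sum_dilates {ι : Type*} (l : ι → ℤ) (s : Finset ι) (hs : s.Nonempty)
    (hl : ∀ i ∈ s, l i ≠ 0) (A : Finset ℤ) (hA : A.Nonempty) :
    A.card ≤ (∑ i ∈ s, A.image fun a => l i • a).card := by
  classical
  obtain ⟨i, hi⟩ := hs
  obtain ⟨a, ha⟩ := hA
  rw [← Finset.add_sum_erase s _ hi]
  refine le_trans (Finset.card_image_of_injective A (smul_right_injective ℤ (hl i hi))).ge
    (Finset.card_le_card_add_right ⟨_, (mem_sum_finset _ _ _).2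
      ⟨fun j => l j • a, fun j _ => Finset.mem_image_of_mem _ ha, rfl⟩⟩)

theorem card_three_sub_two_le_of_sum_dilates {ι : Type*} [Fintype ι] [Nontrivial ι] (l : ι → ℤ)
    (hl : ∀ i, l i ≠ 0) (M : ℕ) (A : Finset ℤ) (hA : A.Nonempty)
    (h : (∑ i, A.image fun a => l i • a).card ≤ M * A.card) :
    (A + A + A - (A + A)).card ≤ M ^ 6 * A.card := by
  classical
  obtain ⟨i, j, hij⟩ := exists_pair_ne ι
  have hinj : Function.Injective (l i • · : ℤ → ℤ) := smul_right_injective ℤ (hl i)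
  have hcard : (A.image fun a => l i • a).card = A.card := Finset.card_image_of_injective A hinj
  rw [← Finset.sum_erase_add _ _ (Finset.mem_univ i)] at h
  have key := card_three_sub_two_le _ _ M (hA.image _) (hcard.trans_le
    (card_le_card_sum_dilates l _ ⟨j, Finset.mem_erase.2 ⟨hij.symm, Finset.mem_univ j⟩⟩
      (fun i _ => hl i) A hA)) (by rwa [hcard])
  rw [hcard] at key
  refine le_trans (Finset.card_le_card_of_injOn (l i • ·) (fun z hz => ?_) hinj.injOn) key
  simp only [Finset.coe_sub, Finset.coe_add, Set.mem_sub, Set.mem_add, Finset.mem_coe] at hz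
  obtain ⟨_, ⟨_, ⟨a, ha, b, hb, rfl⟩, c, hc, rfl⟩, _, ⟨d, hd, e, he, rfl⟩, rfl⟩ := hz
  have hm {x : ℤ} (hx : x ∈ A) : l i • x ∈ A.image fun a => l i • a :=
    Finset.mem_image_of_mem _ hx
  simp only [smul_sub, smul_add]
  exact Finset.sub_mem_sub (Finset.add_mem_add (Finset.add_mem_add (hm ha) (hm hb)) (hm hc))
    (Finset.add_mem_add (hm hd) (hm he))

/-- In a large set of small doubling, most elements lie in classes modulo some `Q` all of whose
subclasses modulo `Q * U` are hit. -/
theorem exists_full_cells_of_card_le (K U d : ℕ) (hU : 0 < U) (hd : 0 < d) :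
    ∃ N : ℕ, ∀ A : Finset ℤ, N ≤ A.card → (A + A + A - (A + A)).card ≤ K * A.card →
      ∃ Q : ℕ, 0 < Q ∧ ∃ B ⊆ A,
        (∀ a ∈ B, ∀ t : ℤ, ∃ b ∈ B, ((Q * U : ℕ) : ℤ) ∣ b - (a + Q * t)) ∧
        (d + 1) * A.card ≤ (d + 1) * B.card + U * K * A.card := by
  obtain ⟨J, hJ⟩ : ∃ J, 2 * K * d ^ J < (d + 1) ^ J := by
    refine ⟨2 * K * d, ?_⟩
    have h1 := add_mul_pow_le_mul_succ_pow d (2 * K * d)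
    have h2 : 0 < d ^ (2 * K * d) := by positivity
    refine Nat.lt_of_mul_lt_mul_left (a := d) (lt_of_lt_of_le ?_ h1)
    nlinarith [Nat.mul_pos hd h2]
  obtain ⟨N, hN⟩ := exists_dense_cell (U ^ J) (by positivity) (4 * K)
  refine ⟨N + 1, fun A hAN hA => ?_⟩
  have hne : A.Nonempty := Finset.card_pos.1 (by omega)
  obtain ⟨Q₀, hQ₀, r, hr⟩ := hN A (by omega) (by rw [mul_assoc]; omega)
  have hK : (A + A + A).card ≤ K * A.card :=
    le_trans (Finset.card_le_card_sub_right (hne.add hne)) hA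
  let F : ℕ → ℕ := fun n => (A.image fun a : ℤ => (a : ZMod n)).card
  have hF0 : F (Q₀ * U ^ 0) = F Q₀ := by rw [pow_zero, mul_one]
  obtain ⟨j, hj⟩ := exists_large_step (fun j => F (Q₀ * U ^ j)) (hne.image _).card_pos
    (2 * K) U d J hU hJ (by
      have h1 := card_residues_mul_card_image_cell_le A hne K Q₀ (U ^ J) hK r
      simp only [hF0]
      calc F Q₀ * U ^ J ≤ F Q₀ * _ := Nat.mul_le_mul_left _ hr
        _ = 2 * (F Q₀ * _) := by ring
        _ ≤ 2 * (K * F (Q₀ * U ^ J)) := Nat.mul_le_mul_left 2 h1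
        _ = _ := by ring)
  have hstep : F (Q₀ * U ^ (j + 1)) = F (Q₀ * U ^ j * U) := by rw [pow_succ, mul_assoc]
  rw [hstep] at hj
  exact ⟨Q₀ * U ^ j, by positivity, exists_full_cells A hne K _ U (d + 1) hU hK hj⟩

theorem bukh_sums_of_dilates (k : ℕ) (hk : 1 ≤ k) (l : Fin k → ℤ)
    (hl : ∀ i, l i ≠ 0) (hgcd : Finset.univ.gcd l = 1)
    (M : ℕ) (hM : (M : ℤ) = ∑ i, |l i|)
    (ε : ℝ) (hε : 0 < ε) :
    ∃ N : ℕ, ∀ A : Finset ℤ, N ≤ A.card →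
      ((M : ℝ) - ε) * A.card ≤ ((∑ i, A.image fun a => l i • a).card : ℝ) := by
  have huniv : (Finset.univ : Finset (Fin k)).Nonempty := ⟨⟨0, hk⟩, Finset.mem_univ _⟩
  rcases hk.eq_or_lt with rfl | hk2
  · refine ⟨1, fun A hA => ?_⟩
    have hM1 : M = 1 := by
      rw [Finset.univ_unique] at hgcd hM
      rw [Finset.gcd_singleton, ← Int.abs_eq_normalize] at hgcd
      rw [Finset.sum_singleton, hgcd] at hM
      exact_mod_cast hM
    have h1 : (A.card : ℝ) ≤ _ := Nat.cast_le.2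
      (card_le_card_sum_dilates l Finset.univ huniv (fun i _ => hl i) A (Finset.card_pos.1 hA))
    have h2 : (0 : ℝ) ≤ ε * A.card := by positivity
    rw [hM1, Nat.cast_one]
    linarith
  have : Nontrivial (Fin k) := Fin.nontrivial_iff_two_le.2 hk2
  have hMpos : 1 ≤ M := by
    have : (0 : ℤ) < ∑ i, |l i| := Finset.sum_pos (fun i _ => abs_pos.2 (hl i)) huniv
    omega
  set m : ℤ := ∏ i, l i
  have hm0 : m ≠ 0 := Finset.prod_ne_zero_iff.2 fun i _ => hl i
  obtain ⟨c₀, hc₀⟩ := card_sum_dilates_of_residues l m Finset.univ huniv (fun i _ => hl i)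
    fun i hi => Finset.dvd_prod_of_mem l hi
  obtain ⟨c, hc⟩ : ∃ c : ℕ, c₀ ≤ c := ⟨c₀.toNat, Int.self_le_toNat c₀⟩
  obtain ⟨n, hn⟩ := exists_nat_ge (max (2 * c / ε) (max c 1))
  simp only [max_le_iff] at hn
  obtain ⟨hn1, hn2, hn3⟩ := hn
  have hn2' : c ≤ n := by exact_mod_cast hn2
  have hn3' : 1 ≤ n := by exact_mod_cast hn3
  have hmpos : 0 < m.natAbs := Int.natAbs_pos.2 hm0
  set U := m.natAbs * n
  have hnU : n ≤ U := Nat.le_mul_of_pos_left n hmpos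
  have hUpos : 0 < U := by omega
  have hcU : 2 * (c : ℝ) ≤ ε * U := by
    have h1 : (n : ℝ) ≤ U := by exact_mod_cast hnU
    rw [div_le_iff₀ hε] at hn1
    nlinarith
  obtain ⟨d, hd⟩ := exists_nat_ge (max (2 * M * U * M ^ 6 / ε) 1)
  simp only [max_le_iff] at hd
  obtain ⟨hd1, hd2⟩ := hd
  rw [div_le_iff₀ hε] at hd1
  obtain ⟨N, hN⟩ := exists_full_cells_of_card_le (M ^ 6) U d hUpos (by exact_mod_cast hd2)
  refine ⟨N + 1, fun A hA => ?_⟩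
  have hne : A.Nonempty := Finset.card_pos.1 (by omega)
  by_contra! hlt
  have hsmall : (∑ i, A.image fun a => l i • a).card ≤ M * A.card := by
    have : (0 : ℝ) ≤ ε * A.card := by positivity
    have : ((∑ i, A.image fun a => l i • a).card : ℝ) ≤ (M * A.card : ℕ) := by
      push_cast
      linarith
    exact_mod_cast this
  obtain ⟨Q, hQ, B, hBA, hfull, hB⟩ := hN A (by omega)
    (card_three_sub_two_le_of_sum_dilates l hl M A hne hsmall)
  have hsumB := card_sum_dilates_of_full_cells l hgcd m c (fun C hC => by
      have := (hc₀ C fun i _ => hC i).2.2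
      rw [hgcd, one_mul] at this
      linarith) (Nat.cast_nonneg c) Q U hQ
    (Int.dvd_natCast.2 (Nat.dvd_mul_right _ _)) hUpos (by
      rw [← hM]
      have : c ≤ M * U := by nlinarith
      exact_mod_cast this) B hfull
  rw [← hM] at hsumB
  have hmono : (∑ i, B.image fun a => l i • a).card ≤ (∑ i, A.image fun a => l i • a).card := by
    refine Finset.card_le_card fun z hz => ?_
    obtain ⟨g, hg, rfl⟩ := (mem_sum_finset _ _ _).1 hz
    exact (mem_sum_finset _ _ _).2
      ⟨g, fun i hi => Finset.image_subset_image hBA (hg i hi), rfl⟩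
  set S := (∑ i, A.image fun a => l i • a).card
  have hBcard : (B.card : ℝ) ≤ A.card := by exact_mod_cast Finset.card_le_card hBA
  have hApos : (0 : ℝ) < A.card := by exact_mod_cast hne.card_pos
  have h1 : ((M : ℝ) * U - c) * B.card ≤ U * S := by
    have : ((M : ℤ) * U - c) * B.card ≤ U * S :=
      hsumB.trans (mul_le_mul_of_nonneg_left (by exact_mod_cast hmono) (Nat.cast_nonneg U))
    exact_mod_cast this
  have hU' : (0 : ℝ) < U := by exact_mod_cast hUpos
  have h2 : (M : ℝ) * B.card - ε / 2 * A.card ≤ S := by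
    refine le_of_mul_le_mul_left ?_ hU'
    have h3 : (c : ℝ) * B.card ≤ ε * U / 2 * A.card :=
      mul_le_mul (by linarith) hBcard (Nat.cast_nonneg _) (by positivity)
    nlinarith
  have h4 : ((d : ℝ) + 1) * A.card ≤ (d + 1) * B.card + U * M ^ 6 * A.card := by exact_mod_cast hB
  have h5 : (M : ℝ) * A.card - ε / 2 * A.card ≤ M * B.card := by
    have hd0 : (0 : ℝ) < d + 1 := by positivity
    refine le_of_mul_le_mul_left ?_ hd0
    have h6 := mul_le_mul_of_nonneg_left h4 (Nat.cast_nonneg (α := ℝ) M)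
    have h7 := mul_le_mul_of_nonneg_right hd1 hApos.le
    nlinarith [mul_pos hε hApos]
  linarith
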